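/- Let (Ω, μ) be a σ-finite measure space, let p ∈ [1, ∞), and let (T_t)_{t ∈ [0,∞)} be a positive and contractive C₀-semigroup on L^p(Ω, μ; ℝ). Assume there exists f₀ ∈ L^p with T_t f₀ = f₀ for all t ≥ 0 and f₀(x) > 0 for μ-almost every x ∈ Ω, and assume condition (*): for every f ∈ L^p with f ≥ 0, f ≠ 0 and T_t f = f for all t ≥ 0, there exist a time t ≥ 0 and a positive integral operator K on L^p such that K g ≤ T_t g for all g ≥ 0 and K f ≠ 0. Then for every f ∈ L^p the orbit {T_t f : t ∈ [0, ∞)} is relatively compact in L^p. -/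

import Mathlib

open MeasureTheory Filter
open scoped ENNReal NNReal

noncomputable section

/-- A bounded linear operator on `L^p` is positive if it maps a.e.-nonnegative functions
to a.e.-nonnegative functions. -/
def IsPositiveOp {Ω : Type*} [MeasurableSpace Ω] {μ : Measure Ω} {p : ℝ≥0∞} [Fact (1 ≤ p)]
    (T : Lp ℝ p μ →L[ℝ] Lp ℝ p μ) : Prop :=
  ∀ f : Lp ℝ p μ, 0 ≤ f → 0 ≤ T f

/-- A bounded linear operator on `L^p` is an integral operator if there is a
nonnegative measurable kernel `k : Ω × Ω → [0,∞)` such that for every `f ∈ L^p` the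
function `x ↦ k x y * f x` is integrable for a.e. `y` and
`(T f)(y) = ∫ k x y * f x dμ(x)` for a.e. `y`. -/
def IsIntegralOp {Ω : Type*} [MeasurableSpace Ω] {μ : Measure Ω} {p : ℝ≥0∞} [Fact (1 ≤ p)]
    (T : Lp ℝ p μ →L[ℝ] Lp ℝ p μ) : Prop :=
  ∃ k : Ω → Ω → ℝ, Measurable (Function.uncurry k) ∧ (∀ x y, 0 ≤ k x y) ∧
    ∀ f : Lp ℝ p μ,
      (∀ᵐ y ∂μ, Integrable (fun x => k x y * f x) μ) ∧
      (T f : Ω → ℝ) =ᵐ[μ] fun y => ∫ x, k x y * f x ∂μ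

open Set Topology

section OrderNorm

variable {Ω : Type*} [MeasurableSpace Ω] {μ : Measure Ω} {p : ℝ≥0∞} [Fact (1 ≤ p)]

/-- The norm of `L^p` is `p`-superadditive on the positive cone. -/
lemma Lp_norm_sub_rpow_add_le (hp : p ≠ ∞) {a b : Lp ℝ p μ} (ha : 0 ≤ a) (hab : a ≤ b) :
    ‖b - a‖ ^ p.toReal + ‖a‖ ^ p.toReal ≤ ‖b‖ ^ p.toReal := by
  have h1 : 1 ≤ p := Fact.out
  have hp0 : p ≠ 0 := (zero_lt_one.trans_le h1).ne'
  have hp1 : 1 ≤ p.toReal := by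
    simpa using ENNReal.toReal_mono hp h1
  have key : ∀ f : Lp ℝ p μ, ‖f‖ₑ ^ p.toReal = ∫⁻ x, ‖f x‖ₑ ^ p.toReal ∂μ := fun f => by
    rw [Lp.enorm_def, eLpNorm_eq_lintegral_rpow_enorm_toReal hp0 hp, ← ENNReal.rpow_mul]
    rw [one_div, inv_mul_cancel₀ (by positivity), ENNReal.rpow_one]
  have hE : ‖b - a‖ₑ ^ p.toReal + ‖a‖ₑ ^ p.toReal ≤ ‖b‖ₑ ^ p.toReal := by
    rw [key, key, key, ← lintegral_add_right' _
      ((Lp.aestronglyMeasurable a).enorm.pow_const _)]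
    refine lintegral_mono_ae ?_
    filter_upwards [Lp.coeFn_sub b a, (Lp.coeFn_nonneg a).2 ha, (Lp.coeFn_le a b).2 hab]
      with x h1 h2 h3
    rw [h1, Pi.sub_apply]
    refine (ENNReal.add_rpow_le_rpow_add _ _ hp1).trans ?_
    gcongr
    simp only [Pi.zero_apply] at h2
    rw [Real.enorm_of_nonneg (sub_nonneg.2 h3), Real.enorm_of_nonneg h2,
      Real.enorm_of_nonneg (h2.trans h3), ← ENNReal.ofReal_add (sub_nonneg.2 h3) h2,
      sub_add_cancel]
  have hconv : ∀ f : Lp ℝ p μ, ‖f‖ₑ ^ p.toReal = ENNReal.ofReal (‖f‖ ^ p.toReal) := fun f => by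
    rw [← ofReal_norm, ENNReal.ofReal_rpow_of_nonneg (norm_nonneg _) (by positivity)]
  rw [hconv, hconv, hconv, ← ENNReal.ofReal_add (by positivity) (by positivity)] at hE
  exact (ENNReal.ofReal_le_ofReal_iff (by positivity)).1 hE

lemma Lp_eq_of_le_of_norm_le (hp : p ≠ ∞) {a b : Lp ℝ p μ} (ha : 0 ≤ a) (hab : a ≤ b)
    (hn : ‖b‖ ≤ ‖a‖) : b = a := by
  have hp0 : 0 < p.toReal := ENNReal.toReal_pos (zero_lt_one.trans_le Fact.out).ne' hp
  have h := Lp_norm_sub_rpow_add_le hp ha hab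
  have h2 : ‖b‖ ^ p.toReal ≤ ‖a‖ ^ p.toReal := by gcongr
  by_contra hne
  have : 0 < ‖b - a‖ ^ p.toReal :=
    Real.rpow_pos_of_pos (norm_pos_iff.2 (sub_ne_zero.2 hne)) _
  linarith

/-- Decreasing sequences in the positive cone of `L^p` converge in norm. -/
lemma Lp_exists_tendsto_of_antitone (hp : p ≠ ∞) {g : ℕ → Lp ℝ p μ} (hg : Antitone g)
    (h0 : ∀ n, 0 ≤ g n) : ∃ h, Tendsto g atTop (𝓝 h) := by
  have hp0 : 0 < p.toReal := ENNReal.toReal_pos (zero_lt_one.trans_le Fact.out).ne' hp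
  apply cauchySeq_tendsto_of_complete
  have hsub : ∀ m n, m ≤ n →
      ‖g m - g n‖ ^ p.toReal + ‖g n‖ ^ p.toReal ≤ ‖g m‖ ^ p.toReal :=
    fun m n hmn => Lp_norm_sub_rpow_add_le hp (h0 n) (hg hmn)
  have hanti : Antitone fun n => ‖g n‖ ^ p.toReal := fun m n hmn => by
    have := hsub m n hmn
    have : 0 ≤ ‖g m - g n‖ ^ p.toReal := by positivity
    dsimp only
    linarith
  have hbdd : BddBelow (range fun n => ‖g n‖ ^ p.toReal) :=
    ⟨0, by rintro _ ⟨n, rfl⟩; dsimp only; positivity⟩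
  have hlim := tendsto_atTop_ciInf hanti hbdd
  rw [Metric.cauchySeq_iff']
  intro ε hε
  have hε' : 0 < ε ^ p.toReal := by positivity
  obtain ⟨N, hN⟩ := (hlim.eventually (gt_mem_nhds (lt_add_of_pos_right _ hε'))).exists
  refine ⟨N, fun n hn => ?_⟩
  rw [dist_comm, dist_eq_norm]
  refine (Real.rpow_lt_rpow_iff (norm_nonneg _) hε.le hp0).1 ?_
  have h1 := hsub N n hn
  have h2 := ciInf_le hbdd n
  linarith

end OrderNorm

section OrderNet

variable {Ω : Type*} [MeasurableSpace Ω] {μ : Measure Ω} {p : ℝ≥0∞}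

/-- `B` is covered, up to arbitrarily small norm errors, by finitely many translates of the order
interval `[-h, h]`. -/
def HasOrderNet (B : Set (Lp ℝ p μ)) (h : Lp ℝ p μ) : Prop :=
  ∀ ε > 0, ∃ C : Set (Lp ℝ p μ), C.Finite ∧ ∀ b ∈ B, ∃ c ∈ C, ‖(|b - c| - h)⁺‖ ≤ ε

lemma HasOrderNet.mono_set {B B' : Set (Lp ℝ p μ)} {h : Lp ℝ p μ} (hB : HasOrderNet B h)
    (hsub : B' ⊆ B) : HasOrderNet B' h := fun ε hε =>
  let ⟨C, hC, H⟩ := hB ε hε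
  ⟨C, hC, fun b hb => H b (hsub hb)⟩

lemma HasOrderNet.union {B B' : Set (Lp ℝ p μ)} {h : Lp ℝ p μ} (hB : HasOrderNet B h)
    (hB' : HasOrderNet B' h) : HasOrderNet (B ∪ B') h := by
  intro ε hε
  obtain ⟨C, hC, H⟩ := hB ε hε
  obtain ⟨C', hC', H'⟩ := hB' ε hε
  refine ⟨C ∪ C', hC.union hC', ?_⟩
  rintro b (hb | hb)
  · obtain ⟨c, hc, h⟩ := H b hb
    exact ⟨c, Or.inl hc, h⟩
  · obtain ⟨c, hc, h⟩ := H' b hb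
    exact ⟨c, Or.inr hc, h⟩

variable [Fact (1 ≤ p)]

lemma norm_le_norm_of_nonneg_of_le {a b : Lp ℝ p μ} (ha : 0 ≤ a) (hab : a ≤ b) : ‖a‖ ≤ ‖b‖ := by
  apply norm_le_norm_of_abs_le_abs
  rwa [abs_of_nonneg ha, abs_of_nonneg (ha.trans hab)]

lemma norm_posPart_le_of_le {a b : Lp ℝ p μ} (hb : 0 ≤ b) (hab : a ≤ b) : ‖a⁺‖ ≤ ‖b‖ :=
  norm_le_norm_of_nonneg_of_le (posPart_nonneg a) (sup_le hab hb)

lemma hasOrderNet_of_totallyBounded {B : Set (Lp ℝ p μ)} (hB : TotallyBounded B)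
    {h : Lp ℝ p μ} (hh : 0 ≤ h) : HasOrderNet B h := by
  intro ε hε
  obtain ⟨C, hC, H⟩ := Metric.totallyBounded_iff.1 hB ε hε
  refine ⟨C, hC, fun b hb => ?_⟩
  obtain ⟨c, hc, hbc⟩ := mem_iUnion₂.1 (H hb)
  rw [Metric.mem_ball, dist_eq_norm] at hbc
  refine ⟨c, hc, ?_⟩
  calc _ ≤ ‖|b - c|‖ := norm_posPart_le_of_le (abs_nonneg _) (sub_le_self _ hh)
    _ = ‖b - c‖ := norm_abs_eq_norm _
    _ ≤ ε := hbc.le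

lemma HasOrderNet.totallyBounded {B : Set (Lp ℝ p μ)} (hB : HasOrderNet B 0) :
    TotallyBounded B := by
  refine Metric.totallyBounded_iff.2 fun ε hε => ?_
  obtain ⟨C, hC, H⟩ := hB (ε / 2) (by positivity)
  refine ⟨C, hC, fun b hb => ?_⟩
  obtain ⟨c, hc, h⟩ := H b hb
  rw [sub_zero, posPart_of_nonneg (abs_nonneg _), norm_abs_eq_norm] at h
  refine mem_iUnion₂.2 ⟨c, hc, ?_⟩
  rw [Metric.mem_ball, dist_eq_norm]
  linarith

lemma hasOrderNet_of_abs_le {B : Set (Lp ℝ p μ)} {h : Lp ℝ p μ} (hB : ∀ b ∈ B, |b| ≤ h) :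
    HasOrderNet B h := fun ε hε =>
  ⟨{0}, finite_singleton 0, fun b hb => ⟨0, rfl, by
    rw [sub_zero, posPart_of_nonpos (sub_nonpos.2 (hB b hb)), norm_zero]; exact hε.le⟩⟩

lemma hasOrderNet_of_tendsto {B : Set (Lp ℝ p μ)} {h : Lp ℝ p μ} {g : ℕ → Lp ℝ p μ}
    (hg : ∀ n, HasOrderNet B (g n)) (hlim : Tendsto g atTop (𝓝 h)) : HasOrderNet B h := by
  intro ε hε
  obtain ⟨n, hn⟩ := (Metric.tendsto_nhds.1 hlim (ε / 2) (by positivity)).exists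
  obtain ⟨C, hC, H⟩ := hg n (ε / 2) (by positivity)
  refine ⟨C, hC, fun b hb => ?_⟩
  obtain ⟨c, hc, hbc⟩ := H b hb
  refine ⟨c, hc, ?_⟩
  rw [dist_eq_norm] at hn
  calc _ ≤ ‖(|b - c| - g n)⁺ + |g n - h|‖ := by
        refine norm_posPart_le_of_le (add_nonneg (posPart_nonneg _) (abs_nonneg _)) ?_
        calc |b - c| - h = (|b - c| - g n) + (g n - h) := by abel
          _ ≤ _ := add_le_add (le_posPart _) (le_abs_self _)
    _ ≤ ‖(|b - c| - g n)⁺‖ + ‖|g n - h|‖ := norm_add_le _ _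
    _ ≤ ε := by rw [norm_abs_eq_norm]; linarith

lemma abs_sub_midpoint_le {b c c' h h' : ℝ} (u u' : ℝ) (hu : |b - c| - h ≤ u) (hu0 : 0 ≤ u)
    (hu' : |b - c'| - h' ≤ u') (hu0' : 0 ≤ u') :
    |b - (1 / 2 : ℝ) * (max (c - h) (c' - h') + min (c + h) (c' + h'))| - min h h' ≤ u + u' := by
  have h1 := le_abs_self (b - c)
  have h2 := neg_abs_le (b - c)
  have h3 := le_abs_self (b - c')
  have h4 := neg_abs_le (b - c')
  rw [sub_le_iff_le_add, abs_le]
  rcases max_cases (c - h) (c' - h') with ⟨e1, _⟩ | ⟨e1, _⟩ <;>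
  rcases min_cases (c + h) (c' + h') with ⟨e2, _⟩ | ⟨e2, _⟩ <;>
  rcases min_cases h h' with ⟨e3, _⟩ | ⟨e3, _⟩ <;>
  rw [e1, e2, e3] <;> constructor <;> linarith

lemma HasOrderNet.inf {B : Set (Lp ℝ p μ)} {h h' : Lp ℝ p μ}
    (hB : HasOrderNet B h) (hB' : HasOrderNet B h') : HasOrderNet B (h ⊓ h') := by
  intro ε hε
  obtain ⟨C, hC, H⟩ := hB (ε / 2) (by positivity)
  obtain ⟨C', hC', H'⟩ := hB' (ε / 2) (by positivity)
  refine ⟨image2 (fun c c' => (1 / 2 : ℝ) • ((c - h) ⊔ (c' - h') + (c + h) ⊓ (c' + h'))) C C',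
    hC.image2 _ hC', fun b hb => ?_⟩
  obtain ⟨c, hc, hbc⟩ := H b hb
  obtain ⟨c', hc', hbc'⟩ := H' b hb
  refine ⟨_, mem_image2_of_mem hc hc', ?_⟩
  calc _ ≤ ‖(|b - c| - h)⁺ + (|b - c'| - h')⁺‖ := by
        refine norm_posPart_le_of_le (add_nonneg (posPart_nonneg _) (posPart_nonneg _)) ?_
        set u := (|b - c| - h)⁺ with hu
        set u' := (|b - c'| - h')⁺ with hu'
        rw [← Lp.coeFn_le]
        have e1 := (Lp.coeFn_le _ _).2 (le_posPart (|b - c| - h))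
        have e2 := (Lp.coeFn_le _ _).2 (le_posPart (|b - c'| - h'))
        have e3 := (Lp.coeFn_nonneg _).2 (posPart_nonneg (|b - c| - h))
        have e4 := (Lp.coeFn_nonneg _).2 (posPart_nonneg (|b - c'| - h'))
        rw [← hu] at e1 e3
        rw [← hu'] at e2 e4
        set m := (c - h) ⊔ (c' - h') + (c + h) ⊓ (c' + h') with hm
        filter_upwards [e1, e2, e3, e4, Lp.coeFn_sub (|b - c|) h, Lp.coeFn_sub (|b - c'|) h',
          Lp.coeFn_abs (b - c), Lp.coeFn_abs (b - c'), Lp.coeFn_sub b c, Lp.coeFn_sub b c',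
          Lp.coeFn_add u u', Lp.coeFn_sub (|b - (1 / 2 : ℝ) • m|) (h ⊓ h'),
          Lp.coeFn_abs (b - (1 / 2 : ℝ) • m), Lp.coeFn_sub b ((1 / 2 : ℝ) • m),
          Lp.coeFn_smul (1 / 2 : ℝ) m, Lp.coeFn_add ((c - h) ⊔ (c' - h')) ((c + h) ⊓ (c' + h')),
          Lp.coeFn_sup (c - h) (c' - h'), Lp.coeFn_inf (c + h) (c' + h'), Lp.coeFn_sub c h,
          Lp.coeFn_sub c' h', Lp.coeFn_add c h, Lp.coeFn_add c' h', Lp.coeFn_inf h h']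
          with x e1 e2 e3 e4 f1 f2 f3 f4 f5 f6 f7 f8 f9 f10 f11 f12 f13 f14 f15 f16 f17 f18 f19
        simp only [Pi.sub_apply, Pi.add_apply, Pi.sup_apply, Pi.inf_apply, Pi.smul_apply,
          Pi.zero_apply, smul_eq_mul] at *
        rw [f1, f3, f5] at e1
        rw [f2, f4, f6] at e2
        rw [f7, f8, f9, f10, f11, hm, f12, f13, f14, f15, f16, f17, f18, f19]
        exact abs_sub_midpoint_le _ _ e1 e3 e2 e4
    _ ≤ _ := norm_add_le _ _
    _ ≤ ε := by linarith

/-- Among the nonnegative `h` for which `B` has an order net of width `h` there is a smallest one. -/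
lemma HasOrderNet.exists_minimal (hp : p ≠ ∞) {B : Set (Lp ℝ p μ)} {h₁ : Lp ℝ p μ} (h0 : 0 ≤ h₁)
    (hB : HasOrderNet B h₁) :
    ∃ h, 0 ≤ h ∧ HasOrderNet B h ∧ ∀ h', 0 ≤ h' → HasOrderNet B h' → h ≤ h' := by
  let S : Set (Lp ℝ p μ) := {h | 0 ≤ h ∧ HasOrderNet B h}
  have hSinf : ∀ {a b}, a ∈ S → b ∈ S → a ⊓ b ∈ S := fun ha hb =>
    ⟨le_inf ha.1 hb.1, ha.2.inf hb.2⟩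
  have hne : (norm '' S).Nonempty := ⟨_, mem_image_of_mem _ ⟨h0, hB⟩⟩
  have hbdd : BddBelow (norm '' S) := ⟨0, by rintro _ ⟨a, -, rfl⟩; exact norm_nonneg a⟩
  obtain ⟨r, -, hr, hrS⟩ := exists_seq_tendsto_sInf hne hbdd
  choose a haS har using hrS
  let g : ℕ → Lp ℝ p μ := fun n => Nat.rec (a 0) (fun k x => x ⊓ a (k + 1)) n
  have hgS : ∀ n, g n ∈ S := fun n => by
    induction n with
    | zero => exact haS 0
    | succ k ih => exact hSinf ih (haS _)
  have hanti : Antitone g := antitone_nat_of_succ_le fun n => inf_le_left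
  have hga : ∀ n, g n ≤ a n := fun n => by
    cases n with
    | zero => exact le_rfl
    | succ k => exact inf_le_right
  obtain ⟨h, hlim⟩ := Lp_exists_tendsto_of_antitone hp hanti fun n => (hgS n).1
  have hh0 : 0 ≤ h := ge_of_tendsto' hlim fun n => (hgS n).1
  have hhS : h ∈ S := ⟨hh0, hasOrderNet_of_tendsto (fun n => (hgS n).2) hlim⟩
  have hnorm : ‖h‖ ≤ sInf (norm '' S) := by
    refine le_of_tendsto_of_tendsto' hlim.norm hr fun n => ?_
    rw [← har]
    exact norm_le_norm_of_nonneg_of_le (hgS n).1 (hga n)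
  refine ⟨h, hh0, hhS.2, fun h' h0' hh' => ?_⟩
  have hm : h ⊓ h' ∈ S := hSinf hhS ⟨h0', hh'⟩
  have := Lp_eq_of_le_of_norm_le hp hm.1 inf_le_left
    (hnorm.trans (csInf_le hbdd (mem_image_of_mem _ hm)))
  rw [this]
  exact inf_le_right

end OrderNet

section PositiveOperators

variable {Ω : Type*} [MeasurableSpace Ω] {μ : Measure Ω} {p : ℝ≥0∞}

lemma Lp_exists_truncation (x : Lp ℝ p μ) {h : Lp ℝ p μ} (hh : 0 ≤ h) :
    ∃ d : Lp ℝ p μ, |d| ≤ h ∧ |x - d| ≤ (|x| - h)⁺ := by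
  refine ⟨x ⊓ h ⊔ -h, abs_le'.2 ⟨sup_le inf_le_right (neg_le_self hh), ?_⟩, ?_⟩
  · rw [neg_le]
    exact le_sup_right
  · rw [posPart_def, ← Lp.coeFn_le]
    filter_upwards [(Lp.coeFn_nonneg h).2 hh, Lp.coeFn_abs (x - (x ⊓ h ⊔ -h)),
      Lp.coeFn_sub x (x ⊓ h ⊔ -h), Lp.coeFn_sup (x ⊓ h) (-h), Lp.coeFn_inf x h, Lp.coeFn_neg h,
      Lp.coeFn_sup (|x| - h) 0, Lp.coeFn_sub |x| h, Lp.coeFn_abs x, Lp.coeFn_zero ℝ p μ]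
      with y e0 e1 e2 e3 e4 e5 e6 e7 e8 e9
    simp only [Pi.sub_apply, Pi.sup_apply, Pi.inf_apply, Pi.neg_apply, Pi.zero_apply] at *
    rw [e1, e2, e3, e4, e5, e6, e7, e8, e9, abs_le]
    have h1 := le_abs_self (x y)
    have h2 := neg_abs_le (x y)
    have h3 := le_max_left (|x y| - h y) 0
    have h4 := le_max_right (|x y| - h y) 0
    rcases max_cases (min (x y) (h y)) (-h y) with ⟨a, _⟩ | ⟨a, _⟩ <;>
    rcases min_cases (x y) (h y) with ⟨b, _⟩ | ⟨b, _⟩ <;>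
    constructor <;> linarith

variable [Fact (1 ≤ p)]

lemma IsPositiveOp.mono {T : Lp ℝ p μ →L[ℝ] Lp ℝ p μ} (hT : IsPositiveOp T) {f g : Lp ℝ p μ}
    (hfg : f ≤ g) : T f ≤ T g := by
  rw [← sub_nonneg, ← map_sub]
  exact hT _ (sub_nonneg.2 hfg)

lemma IsPositiveOp.abs_apply_le {T : Lp ℝ p μ →L[ℝ] Lp ℝ p μ} (hT : IsPositiveOp T)
    (f : Lp ℝ p μ) : |T f| ≤ T |f| := by
  refine abs_le'.2 ⟨hT.mono (le_abs_self f), ?_⟩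
  rw [← map_neg]
  exact hT.mono (neg_le_abs f)

/-- If a positive contraction `T` dominates a positive operator `K` which is compact on the order
interval `[-h, h]`, then `T` maps sets with order nets of width `h` to sets with order nets of
width `T h - K h`. -/
lemma HasOrderNet.image {T K : Lp ℝ p μ →L[ℝ] Lp ℝ p μ} (hT : IsPositiveOp T)
    (hTc : ∀ f, ‖T f‖ ≤ ‖f‖) (hKT : ∀ g, 0 ≤ g → K g ≤ T g) {h : Lp ℝ p μ} (hh : 0 ≤ h)
    (hK : TotallyBounded (K '' {d | |d| ≤ h})) {B : Set (Lp ℝ p μ)} (hB : HasOrderNet B h) :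
    HasOrderNet (T '' B) (T h - K h) := by
  have hS : IsPositiveOp (T - K) := fun g hg => by
    simpa using hKT g hg
  intro ε hε
  obtain ⟨C, hC, H⟩ := hB (ε / 2) (by positivity)
  obtain ⟨D, hD, HD⟩ := Metric.totallyBounded_iff.1 hK (ε / 2) (by positivity)
  refine ⟨image2 (fun c δ => T c + δ) C D, hC.image2 _ hD, ?_⟩
  rintro _ ⟨b, hb, rfl⟩
  obtain ⟨c, hc, hbc⟩ := H b hb
  obtain ⟨d, hd, hed⟩ := Lp_exists_truncation (b - c) hh
  obtain ⟨δ, hδ, hdδ⟩ := mem_iUnion₂.1 (HD (mem_image_of_mem K hd))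
  rw [Metric.mem_ball, dist_eq_norm] at hdδ
  refine ⟨_, mem_image2_of_mem hc hδ, ?_⟩
  set u := (|b - c| - h)⁺
  have hu : 0 ≤ u := posPart_nonneg _
  have hsplit : T b - (T c + δ) = (K d - δ) + (T - K) d + T (b - c - d) := by
    simp only [map_sub, sub_apply]
    abel
  calc _ ≤ ‖|K d - δ| + T u‖ := by
        refine norm_posPart_le_of_le (add_nonneg (abs_nonneg _) (hT u hu)) ?_
        rw [sub_le_iff_le_add, hsplit]
        calc |(K d - δ) + (T - K) d + T (b - c - d)|
            ≤ |K d - δ| + |(T - K) d| + |T (b - c - d)| :=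
              (abs_add_le _ _).trans (add_le_add_left (abs_add_le _ _) _)
          _ ≤ |K d - δ| + (T - K) h + T u := by
              gcongr
              · exact (hS.abs_apply_le d).trans (hS.mono hd)
              · exact (hT.abs_apply_le _).trans (hT.mono hed)
          _ = _ := by
              rw [sub_apply]
              abel
    _ ≤ ‖|K d - δ|‖ + ‖T u‖ := norm_add_le _ _
    _ ≤ ε := by
        rw [norm_abs_eq_norm]
        linarith [hTc u]

end PositiveOperators

section WeakSubsequences

lemma totallyBounded_of_exists_cauchySeq_subseq {X : Type*} [UniformSpace X] {s : Set X}
    (h : ∀ u : ℕ → X, (∀ n, u n ∈ s) → ∃ φ : ℕ → ℕ, StrictMono φ ∧ CauchySeq (u ∘ φ)) :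
    TotallyBounded s := by
  intro V V_in
  contrapose! h
  obtain ⟨u, u_in, hu⟩ : ∃ u : ℕ → X, (∀ n, u n ∈ s) ∧
      ∀ n m, m < n → u m ∉ UniformSpace.ball (u n) V := by
    simp only [not_subset, mem_iUnion₂, not_exists, exists_prop] at h
    simpa only [forall_and, forall_mem_image, not_and] using! seq_of_forall_finite_exists h
  refine ⟨u, u_in, fun φ hφ huφ => ?_⟩
  obtain ⟨N, hN⟩ : ∃ N, ∀ p q, p ≥ N → q ≥ N → (u (φ p), u (φ q)) ∈ V :=
    huφ.mem_entourage V_in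
  exact hu (φ <| N + 1) (φ N) (hφ <| Nat.lt_add_one N) (hN (N + 1) N N.le_succ le_rfl)

lemma cauchySeq_of_forall_exists_cauchySeq {a : ℕ → ℝ}
    (h : ∀ ε > 0, ∃ b : ℕ → ℝ, CauchySeq b ∧ ∀ n, |a n - b n| ≤ ε) : CauchySeq a := by
  rw [Metric.cauchySeq_iff]
  intro ε hε
  obtain ⟨b, hb, hab⟩ := h (ε / 4) (by positivity)
  obtain ⟨N, hN⟩ := Metric.cauchySeq_iff.1 hb (ε / 4) (by positivity)
  refine ⟨N, fun m hm n hn => ?_⟩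
  have h1 := abs_le.1 (hab m)
  have h2 := abs_le.1 (hab n)
  have h3 := hN m hm n hn
  rw [Real.dist_eq, abs_lt] at h3 ⊢
  constructor <;> linarith [h1.1, h1.2, h2.1, h2.2, h3.1, h3.2]

/-- Bounded sequences in a Hilbert space have weakly Cauchy subsequences. -/
lemma exists_subseq_forall_cauchySeq_inner {H : Type*} [NormedAddCommGroup H]
    [InnerProductSpace ℝ H] [CompleteSpace H] {u : ℕ → H} {C : ℝ} (hu : ∀ n, ‖u n‖ ≤ C) :
    ∃ φ : ℕ → ℕ, StrictMono φ ∧ ∀ v, CauchySeq fun n => inner ℝ (u (φ n)) v := by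
  have hC : 0 ≤ C := (norm_nonneg _).trans (hu 0)
  have hcpt : IsCompact (univ.pi fun _ : ℕ => Metric.closedBall (0 : ℝ) (C * C)) :=
    isCompact_univ_pi fun _ => isCompact_closedBall _ _
  obtain ⟨l, -, φ, hφ, hl⟩ := hcpt.tendsto_subseq (x := fun n m => inner ℝ (u n) (u m))
    fun n m _ => by
      rw [mem_closedBall_zero_iff]
      exact (norm_inner_le_norm _ _).trans (mul_le_mul (hu n) (hu m) (norm_nonneg _) hC)
  let W : Submodule ℝ H :=
    { carrier := {v | CauchySeq fun n => inner ℝ (u (φ n)) v}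
      add_mem' := fun {a b} ha hb => by
        simp only [mem_ofPred_eq, inner_add_right] at *
        exact ha.add hb
      zero_mem' := by
        simp only [mem_ofPred_eq, inner_zero_right]
        exact cauchySeq_const 0
      smul_mem' := fun c a ha => by
        simp only [mem_ofPred_eq, inner_smul_right] at *
        exact (uniformContinuous_const_smul c).comp_cauchySeq ha }
  have hWu : ∀ m, u m ∈ W := fun m => ((tendsto_pi_nhds.1 hl) m).cauchySeq
  have hWc : IsClosed (W : Set H) := by
    refine isClosed_of_closure_subset fun v hv => cauchySeq_of_forall_exists_cauchySeq
      fun ε hε => ?_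
    obtain ⟨v', hv', hd⟩ := Metric.mem_closure_iff.1 hv (ε / (C + 1)) (by positivity)
    refine ⟨fun n => inner ℝ (u (φ n)) v', hv', fun n => ?_⟩
    rw [← inner_sub_right]
    rw [dist_eq_norm, lt_div_iff₀ (by positivity)] at hd
    refine (abs_real_inner_le_norm _ _).trans ?_
    nlinarith [hu (φ n), norm_nonneg (v - v')]
  have hWo : Wᗮ = ⊥ := by
    refine (Submodule.eq_bot_iff _).2 fun v hv => ?_
    have hvW : v ∈ W := by
      have : ∀ n, inner ℝ (u (φ n)) v = (0 : ℝ) := fun n => hv _ (hWu _)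
      change CauchySeq fun n => inner ℝ (u (φ n)) v
      simp only [this]
      exact cauchySeq_const 0
    exact inner_self_eq_zero.1 (hv v hvW)
  have : CompleteSpace W := hWc.completeSpace_coe
  have hWtop : W = ⊤ := Submodule.orthogonal_eq_bot_iff.1 hWo
  exact ⟨φ, hφ, fun v => show v ∈ W from hWtop ▸ Submodule.mem_top⟩

variable {Ω : Type*} [MeasurableSpace Ω] {μ : Measure Ω} [SigmaFinite μ]

/-- An order bounded sequence of functions has a subsequence whose integrals against every
sufficiently integrable function converge. -/
lemma exists_subseq_forall_cauchySeq_integral {h : Ω → ℝ} (hh : Measurable h) {f : ℕ → Ω → ℝ}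
    (hf : ∀ n, AEStronglyMeasurable (f n) μ) (hfh : ∀ n, ∀ᵐ x ∂μ, |f n x| ≤ h x) :
    ∃ φ : ℕ → ℕ, StrictMono φ ∧ ∀ v : Ω → ℝ, Measurable v → Integrable (fun x => v x * h x) μ →
      CauchySeq fun n => ∫ x, v x * f (φ n) x ∂μ := by
  obtain ⟨g, g_pos, g_meas, g_int⟩ := exists_pos_lintegral_lt_of_sigmaFinite μ one_ne_zero
  let r : Ω → ℝ := fun x => √(g x)
  have r_pos : ∀ x, 0 < r x := fun x => Real.sqrt_pos.2 (g_pos x)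
  have r_meas : Measurable r := g_meas.coe_nnreal_real.sqrt
  have hr : MemLp r 2 μ := by
    rw [memLp_two_iff_integrable_sq r_meas.aestronglyMeasurable]
    refine ⟨(r_meas.pow_const 2).aestronglyMeasurable, ?_⟩
    refine lt_of_le_of_lt (lintegral_mono fun x => ?_) (g_int.trans ENNReal.one_lt_top)
    simp only [r, Real.sq_sqrt (g x).coe_nonneg]
    simp
  let w : Ω → ℝ := fun x => r x / (1 + |h x|)
  have w_pos : ∀ x, 0 < w x := fun x => div_pos (r_pos x) (by positivity)
  have w_meas : Measurable w := r_meas.div (hh.abs.const_add 1)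
  have hwf : ∀ n, ∀ᵐ x ∂μ, ‖w x * f n x‖ ≤ ‖r x‖ := fun n => by
    filter_upwards [hfh n] with x hx
    rw [norm_mul, Real.norm_eq_abs, Real.norm_eq_abs, Real.norm_eq_abs, abs_of_pos (w_pos x),
      abs_of_pos (r_pos x), div_mul_eq_mul_div, div_le_iff₀ (by positivity)]
    have := r_pos x
    gcongr
    linarith [le_abs_self (h x)]
  have hF : ∀ n, MemLp (fun x => w x * f n x) 2 μ := fun n =>
    hr.of_le (w_meas.aestronglyMeasurable.mul (hf n)) (hwf n)
  obtain ⟨φ, hφ, hφc⟩ := exists_subseq_forall_cauchySeq_inner (u := fun n => (hF n).toLp)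
    (C := ‖hr.toLp‖) fun n => Lp.norm_le_norm_of_ae_le <| by
      filter_upwards [hwf n, (hF n).coeFn_toLp, hr.coeFn_toLp] with x h1 h2 h3
      rwa [h2, h3]
  refine ⟨φ, hφ, fun v hv hvh => cauchySeq_of_forall_exists_cauchySeq fun ε hε => ?_⟩
  have hvf : ∀ n, ∀ v' : Ω → ℝ, Measurable v' → (∀ x, |v' x| ≤ |v x|) →
      Integrable (fun x => v' x * f n x) μ := fun n v' hv' hle => by
    refine hvh.mono (hv'.aestronglyMeasurable.mul (hf n)) ?_
    filter_upwards [hfh n] with x hx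
    rw [norm_mul, norm_mul]
    exact mul_le_mul (hle x) (hx.trans (le_abs_self _)) (norm_nonneg _) (norm_nonneg _)
  let A : ℕ → Set Ω := fun m => {x | |v x| ≤ m * (w x * r x)}
  have hA : ∀ m, MeasurableSet (A m) := fun m =>
    measurableSet_le hv.abs ((w_meas.mul r_meas).const_mul _)
  have hlim : Tendsto (fun m => ∫ x, ‖(A m)ᶜ.indicator v x * h x‖ ∂μ) atTop (𝓝 0) := by
    rw [← integral_zero Ω ℝ (μ := μ)]
    refine tendsto_integral_of_dominated_convergence (fun x => ‖v x * h x‖)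
      (fun m => ((hv.indicator (hA m).compl).mul hh).norm.aestronglyMeasurable) hvh.norm
      (fun m => .of_forall fun x => ?_) (.of_forall fun x => ?_)
    · rw [norm_norm, norm_mul, norm_mul]
      gcongr
      exact norm_indicator_le_norm_self _ _
    · obtain ⟨m, hm⟩ := Archimedean.arch |v x| (mul_pos (w_pos x) (r_pos x))
      refine tendsto_const_nhds.congr' ?_
      filter_upwards [eventually_ge_atTop m] with k hk
      rw [indicator_of_notMem, zero_mul, norm_zero]
      rw [notMem_compl_iff]
      rw [nsmul_eq_mul] at hm
      refine hm.trans ?_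
      have := mul_pos (w_pos x) (r_pos x)
      gcongr
  obtain ⟨m, hm⟩ := (hlim.eventually (gt_mem_nhds hε)).exists
  have hV : MemLp (fun x => (A m).indicator v x / w x) 2 μ := by
    refine (hr.const_mul (m : ℝ)).of_le
      ((hv.indicator (hA m)).div w_meas).aestronglyMeasurable (.of_forall fun x => ?_)
    rw [norm_div, norm_mul, Real.norm_of_nonneg (w_pos x).le, Real.norm_of_nonneg (r_pos x).le,
      div_le_iff₀ (w_pos x), Real.norm_of_nonneg (Nat.cast_nonneg m)]
    by_cases hx : x ∈ A m
    · rw [indicator_of_mem hx]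
      refine (show |v x| ≤ m * (w x * r x) from hx).trans_eq (by ring)
    · rw [indicator_of_notMem hx, norm_zero]
      have := w_pos x
      have := r_pos x
      positivity
  refine ⟨_, hφc hV.toLp, fun n => ?_⟩
  have hinner : inner ℝ (hF (φ n)).toLp hV.toLp = ∫ x, (A m).indicator v x * f (φ n) x ∂μ := by
    rw [L2.inner_def]
    refine integral_congr_ae ?_
    filter_upwards [(hF (φ n)).coeFn_toLp, hV.coeFn_toLp] with x h1 h2
    rw [h1, h2]
    have := (w_pos x).ne'
    simp only [RCLike.inner_apply, conj_trivial]
    field_simp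
  rw [hinner, ← integral_sub (hvf _ _ hv fun x => le_rfl)
    (hvf _ _ (hv.indicator (hA m)) fun x => by
      simpa only [Real.norm_eq_abs] using norm_indicator_le_norm_self v x)]
  refine (abs_integral_le_integral_abs).trans (le_trans ?_ hm.le)
  refine integral_mono_of_nonneg (.of_forall fun x => abs_nonneg _) ?_ ?_
  · refine hvh.norm.mono ((hv.indicator (hA m).compl).mul hh).norm.aestronglyMeasurable
      (.of_forall fun x => ?_)
    rw [norm_norm, norm_norm, norm_mul, norm_mul]
    gcongr
    exact norm_indicator_le_norm_self _ _
  · filter_upwards [hfh (φ n)] with x hx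
    rw [← sub_mul, norm_mul, abs_mul]
    have : v x - (A m).indicator v x = (A m)ᶜ.indicator v x := by
      rw [indicator_compl, Pi.sub_apply]
    rw [this]
    exact mul_le_mul_of_nonneg_left (hx.trans (le_abs_self _)) (abs_nonneg _)

end WeakSubsequences

section IntegralOperators

variable {Ω : Type*} [MeasurableSpace Ω] {μ : Measure Ω} {p : ℝ≥0∞} [Fact (1 ≤ p)]

/-- Dominated convergence in `L^p`. -/
lemma Lp_exists_tendsto_of_abs_le (hp : p ≠ ∞) {F : ℕ → Lp ℝ p μ} {g : Lp ℝ p μ}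
    (hF : ∀ n, |F n| ≤ g) (hlim : ∀ᵐ x ∂μ, ∃ l, Tendsto (fun n => F n x) atTop (𝓝 l)) :
    ∃ f, Tendsto F atTop (𝓝 f) := by
  have hp0 : p ≠ 0 := (zero_lt_one.trans_le Fact.out).ne'
  have hp1 : 0 < p.toReal := ENNReal.toReal_pos hp0 hp
  have hFg : ∀ᵐ x ∂μ, ∀ n, |F n x| ≤ g x := ae_all_iff.2 fun n => by
    filter_upwards [(Lp.coeFn_le _ _).2 (hF n), Lp.coeFn_abs (F n)] with x h1 h2
    rwa [h2] at h1
  obtain ⟨f, hfm, hf⟩ := exists_stronglyMeasurable_limit_of_tendsto_ae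
    (fun n => Lp.aestronglyMeasurable (F n)) hlim
  have hfg : ∀ᵐ x ∂μ, |f x| ≤ g x := by
    filter_upwards [hFg, hf] with x h1 h2
    exact le_of_tendsto' h2.abs h1
  have hfL : MemLp f p μ := (Lp.memLp g).of_le hfm.aestronglyMeasurable <| by
    filter_upwards [hfg] with x hx
    exact hx.trans (le_abs_self _)
  refine ⟨hfL.toLp, ?_⟩
  rw [Lp.tendsto_Lp_iff_tendsto_eLpNorm' F]
  have hint : Tendsto (fun n => ∫⁻ x, ‖F n x - f x‖ₑ ^ p.toReal ∂μ) atTop (𝓝 0) := by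
    rw [← lintegral_zero (μ := μ)]
    refine tendsto_lintegral_of_dominated_convergence' (fun x => ‖2 * g x‖ₑ ^ p.toReal)
      (fun n => ((Lp.aestronglyMeasurable (F n)).sub
        hfm.aestronglyMeasurable).enorm.pow_const _) (fun n => ?_)
      (lintegral_rpow_enorm_lt_top_of_eLpNorm_lt_top hp0 hp
        ((Lp.memLp g).const_mul 2).eLpNorm_lt_top).ne ?_
    · filter_upwards [hFg, hfg] with x h1 h2
      gcongr
      rw [enorm_le_iff_norm_le, Real.norm_eq_abs, Real.norm_eq_abs]
      have := le_abs_self (2 * g x)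
      exact (abs_sub _ _).trans (by linarith [h1 n])
    · filter_upwards [hf] with x hx
      have : Tendsto (fun n => ‖F n x - f x‖ₑ) atTop (𝓝 0) := by
        simpa using (hx.sub_const (f x)).enorm
      simpa [ENNReal.zero_rpow_of_pos hp1] using this.ennrpow_const p.toReal
  have hroot := hint.ennrpow_const (1 / p.toReal)
  rw [ENNReal.zero_rpow_of_pos (by positivity)] at hroot
  refine hroot.congr fun n => ?_
  rw [← eLpNorm_eq_lintegral_rpow_enorm_toReal hp0 hp]
  refine eLpNorm_congr_ae ?_
  filter_upwards [hfL.coeFn_toLp] with x hx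
  simp only [Pi.sub_apply, hx]

/-- Positive integral operators are compact on order intervals. -/
lemma IsIntegralOp.totallyBounded_image [SigmaFinite μ] (hp : p ≠ ∞)
    {K : Lp ℝ p μ →L[ℝ] Lp ℝ p μ} (hK : IsIntegralOp K) (hpos : IsPositiveOp K)
    (h : Lp ℝ p μ) : TotallyBounded (K '' {d | |d| ≤ h}) := by
  obtain ⟨k, hk, -, hKk⟩ := hK
  refine totallyBounded_of_exists_cauchySeq_subseq fun u hu => ?_
  choose d hd hdu using hu
  obtain ⟨φ, hφ, H⟩ := exists_subseq_forall_cauchySeq_integral (μ := μ)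
    (Lp.stronglyMeasurable h).measurable (fun n => Lp.aestronglyMeasurable (d n)) fun n => by
      filter_upwards [(Lp.coeFn_le _ _).2 (hd n), Lp.coeFn_abs (d n)] with x h1 h2
      rwa [h2] at h1
  refine ⟨φ, hφ, ?_⟩
  have hdom : ∀ n, |(u ∘ φ) n| ≤ K h := fun n => by
    rw [Function.comp_apply, ← hdu]
    exact (hpos.abs_apply_le _).trans (hpos.mono (hd _))
  have hlim : ∀ᵐ y ∂μ, ∃ l, Tendsto (fun n => (u ∘ φ) n y) atTop (𝓝 l) := by
    filter_upwards [(hKk h).1, ae_all_iff.2 fun n => (hKk (d n)).2] with y hy hu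
    refine cauchySeq_tendsto_of_complete ?_
    have hky : Measurable fun x => k x y := hk.comp measurable_prodMk_right
    simpa only [Function.comp_apply, ← hdu, hu] using H _ hky hy
  obtain ⟨l, hl⟩ := Lp_exists_tendsto_of_abs_le hp hdom hlim
  exact hl.cauchySeq

end IntegralOperators

section Semigroup

variable {Ω : Type*} [MeasurableSpace Ω] {μ : Measure Ω} {p : ℝ≥0∞} [Fact (1 ≤ p)]

lemma totallyBounded_orbit_of_abs_le [SigmaFinite μ] (hp : p ≠ ∞)
    {T : ℝ≥0 → (Lp ℝ p μ →L[ℝ] Lp ℝ p μ)}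
    (hpos : ∀ t, IsPositiveOp (T t)) (hcontr : ∀ t (f : Lp ℝ p μ), ‖T t f‖ ≤ ‖f‖)
    (hsem : ∀ s t, T (s + t) = (T s).comp (T t))
    (hcont : ∀ f : Lp ℝ p μ, Continuous fun t => T t f)
    (hstar : ∀ f : Lp ℝ p μ, 0 ≤ f → f ≠ 0 → (∀ t, T t f = f) →
      ∃ (t : ℝ≥0) (K : Lp ℝ p μ →L[ℝ] Lp ℝ p μ), IsPositiveOp K ∧ IsIntegralOp K ∧
        (∀ g : Lp ℝ p μ, 0 ≤ g → K g ≤ T t g) ∧ K f ≠ 0)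
    {f₁ f : Lp ℝ p μ} (hfix : ∀ t, T t f₁ = f₁) (hf : |f| ≤ f₁) :
    TotallyBounded (range fun t => T t f) := by
  set B := range fun t => T t f with hBdef
  have hB₁ : HasOrderNet B f₁ := hasOrderNet_of_abs_le <| by
    rintro _ ⟨t, rfl⟩
    exact ((hpos t).abs_apply_le f).trans (((hpos t).mono hf).trans_eq (hfix t))
  obtain ⟨h, hh, hBh, hmin⟩ := hB₁.exists_minimal hp ((abs_nonneg f).trans hf)
  -- the orbit and its image under `T t` differ by a relatively compact set
  have htail : ∀ t g, 0 ≤ g → HasOrderNet (T t '' B) g → HasOrderNet B g := by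
    intro t g hg hBg
    have hcpt : TotallyBounded ((fun s => T s f) '' Icc 0 t) :=
      (isCompact_Icc.image (hcont f)).totallyBounded
    refine ((hasOrderNet_of_totallyBounded hcpt hg).union hBg).mono_set ?_
    rintro _ ⟨s, rfl⟩
    rcases le_total s t with hst | hst
    · exact Or.inl ⟨s, ⟨zero_le, hst⟩, rfl⟩
    · refine Or.inr ⟨_, ⟨s - t, rfl⟩, ?_⟩
      simp only
      rw [← ContinuousLinearMap.comp_apply, ← hsem, add_tsub_cancel_of_le hst]
  have hle : ∀ t (K : Lp ℝ p μ →L[ℝ] Lp ℝ p μ), (∀ g, 0 ≤ g → K g ≤ T t g) →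
      TotallyBounded (K '' {d | |d| ≤ h}) → h ≤ T t h - K h := fun t K hKT hK =>
    have hnn : 0 ≤ T t h - K h := sub_nonneg.2 (hKT h hh)
    hmin _ hnn (htail t _ hnn (hBh.image (hpos t) (hcontr t) hKT hh hK))
  have hhfix : ∀ t, T t h = h := fun t => by
    refine Lp_eq_of_le_of_norm_le hp hh ?_ (hcontr t h)
    have := hle t 0 (fun g hg => hpos t g hg) ?_
    · simpa using this
    · refine (totallyBounded_singleton 0).subset ?_
      rintro _ ⟨d, -, rfl⟩
      rfl
  have hh0 : h = 0 := by
    by_contra hne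
    obtain ⟨t, K, hKpos, hKint, hKT, hKh⟩ := hstar h hh hne hhfix
    have := hle t K hKT (hKint.totallyBounded_image hp hKpos h)
    rw [hhfix t, le_sub_self_iff] at this
    exact hKh (le_antisymm this (hKpos h hh))
  rw [hh0] at hBh
  exact hBh.totallyBounded

/-- The principal ideal generated by an almost everywhere positive function is dense in `L^p`. -/
lemma Lp_exists_abs_le_nsmul (hp : p ≠ ∞) {f₀ : Lp ℝ p μ} (hf₀ : ∀ᵐ x ∂μ, 0 < f₀ x)
    (f : Lp ℝ p μ) {ε : ℝ} (hε : 0 < ε) :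
    ∃ (n : ℕ) (d : Lp ℝ p μ), |d| ≤ n • f₀ ∧ ‖f - d‖ < ε := by
  have h0 : 0 ≤ f₀ := (Lp.coeFn_nonneg f₀).1 (hf₀.mono fun x hx => hx.le)
  let g : ℕ → Lp ℝ p μ := fun n => (|f| - n • f₀)⁺
  have hanti : Antitone g := fun m n hmn =>
    posPart_mono (sub_le_sub_left (nsmul_le_nsmul_left h0 hmn) _)
  obtain ⟨l, hl⟩ := Lp_exists_tendsto_of_antitone hp hanti fun n => posPart_nonneg _
  have hl0 : 0 ≤ l := ge_of_tendsto' hl fun n => posPart_nonneg _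
  have hlg : ∀ n, l ≤ g n := fun n => hanti.le_of_tendsto hl n
  have hlz : l = 0 := by
    refine le_antisymm ((Lp.coeFn_le _ _).1 ?_) hl0
    have hae : ∀ n : ℕ, ∀ᵐ x ∂μ, l x ≤ max (|f x| - n * f₀ x) 0 := fun n => by
      have := (Lp.coeFn_le _ _).2 (hlg n)
      have hsmul := Lp.coeFn_smul (n : ℝ) f₀
      rw [Nat.cast_smul_eq_nsmul] at hsmul
      filter_upwards [this, Lp.coeFn_sup (|f| - n • f₀) 0, Lp.coeFn_sub |f| (n • f₀),
        Lp.coeFn_abs f, hsmul, Lp.coeFn_zero ℝ p μ] with x e1 e2 e3 e4 e5 e6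
      simp only [g, posPart_def] at e1
      simp only [Pi.sub_apply, Pi.sup_apply, Pi.smul_apply, Pi.zero_apply, smul_eq_mul] at *
      rwa [e2, e3, e4, e5, e6] at e1
    filter_upwards [ae_all_iff.2 hae, hf₀, Lp.coeFn_zero ℝ p μ] with x hx hx0 hz
    rw [hz]
    obtain ⟨n, hn⟩ := Archimedean.arch |f x| hx0
    rw [nsmul_eq_mul] at hn
    exact (hx n).trans_eq (max_eq_right (by simpa using hn))
  rw [hlz] at hl
  obtain ⟨n, hn⟩ := (Metric.tendsto_nhds.1 hl ε hε).exists
  obtain ⟨d, hd, hfd⟩ := Lp_exists_truncation f (nsmul_nonneg h0 n)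
  refine ⟨n, d, hd, ?_⟩
  rw [dist_zero_right] at hn
  rw [← norm_abs_eq_norm]
  exact (norm_le_norm_of_nonneg_of_le (abs_nonneg _) hfd).trans_lt hn

end Semigroup

/-- Under condition (*), every orbit of the semigroup is relatively compact in `L^p`. -/
theorem pichor_rudnicki_orbits_relatively_compact
    {Ω : Type*} [MeasurableSpace Ω] (μ : Measure Ω) [SigmaFinite μ]
    (p : ℝ≥0∞) [Fact (1 ≤ p)] (hp : p ≠ ∞)
    (T : ℝ≥0 → (Lp ℝ p μ →L[ℝ] Lp ℝ p μ))
    (hpos : ∀ t, IsPositiveOp (T t))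
    (hcontr : ∀ t (f : Lp ℝ p μ), ‖T t f‖ ≤ ‖f‖)
    (hT0 : T 0 = ContinuousLinearMap.id ℝ (Lp ℝ p μ))
    (hsem : ∀ s t, T (s + t) = (T s).comp (T t))
    (hcont : ∀ f : Lp ℝ p μ, Continuous fun t => T t f)
    (f₀ : Lp ℝ p μ) (hfix : ∀ t, T t f₀ = f₀)
    (hf₀pos : ∀ᵐ x ∂μ, 0 < f₀ x)
    (hstar : ∀ f : Lp ℝ p μ, 0 ≤ f → f ≠ 0 → (∀ t, T t f = f) →
      ∃ (t : ℝ≥0) (K : Lp ℝ p μ →L[ℝ] Lp ℝ p μ), IsPositiveOp K ∧ IsIntegralOp K ∧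
        (∀ g : Lp ℝ p μ, 0 ≤ g → K g ≤ T t g) ∧ K f ≠ 0) :
    ∀ f : Lp ℝ p μ, IsCompact (closure (Set.range fun t => T t f)) := by
  intro f
  refine TotallyBounded.isCompact_of_isClosed (TotallyBounded.closure ?_) isClosed_closure
  refine Metric.totallyBounded_iff.2 fun ε hε => ?_
  obtain ⟨n, d, hd, hfd⟩ := Lp_exists_abs_le_nsmul hp hf₀pos f (half_pos hε)
  have hfix' : ∀ t, T t (n • f₀) = n • f₀ := fun t => by rw [map_nsmul, hfix]
  obtain ⟨C, hC, H⟩ := Metric.totallyBounded_iff.1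
    (totallyBounded_orbit_of_abs_le hp hpos hcontr hsem hcont hstar hfix' hd) (ε / 2) (half_pos hε)
  refine ⟨C, hC, ?_⟩
  rintro _ ⟨t, rfl⟩
  obtain ⟨c, hc, hdc⟩ := mem_iUnion₂.1 (H (mem_range_self t))
  refine mem_iUnion₂.2 ⟨c, hc, ?_⟩
  rw [Metric.mem_ball] at hdc ⊢
  have h1 : dist (T t f) (T t d) ≤ ‖f - d‖ := by
    rw [dist_eq_norm, ← map_sub]
    exact hcontr t _
  linarith [dist_triangle (T t f) (T t d) c]
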